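/- The order complex of the truncated partition lattice satisfies the recurrence $\Delta(\tilde{\Pi}_n) \simeq \bigvee_{i=2}^{n} \Sigma(\Delta(\tilde{\Pi}_{n-1}))$; consequently $\Delta(\tilde{\Pi}_n)$ is homotopy equivalent to a wedge of $(n-1)!$ spheres of dimension $n-3$. -/

import Mathlib

open Function

/-- The (geometric realization of the) order complex of a poset `P`. -/
def orderComplex (P : Type*) [PartialOrder P] : Set (P → ℝ) :=
  {w | (∀ p, 0 ≤ w p) ∧ (support w).Finite ∧ ∑ᶠ p, w p = 1 ∧
    IsChain (· ≤ ·) (support w)}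

/-- The wedge of a family of pointed spaces `(Y i, y₀ i)`. -/
def Wedge {ι : Type*} (Y : ι → Type*) [∀ i, TopologicalSpace (Y i)]
    (y₀ : ∀ i, Y i) : Type _ :=
  Quot (fun a b : Σ i, Y i => a = b ∨ (a.2 = y₀ a.1 ∧ b.2 = y₀ b.1))

instance {ι : Type*} (Y : ι → Type*) [∀ i, TopologicalSpace (Y i)]
    (y₀ : ∀ i, Y i) : TopologicalSpace (Wedge Y y₀) :=
  instTopologicalSpaceQuot

/-- The proper part `Π̃ₙ` of the partition lattice of `{1,…,n}`: all equivalence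
relations (partitions) on `Fin n` other than the discrete one `⊥` and the
indiscrete one `⊤`, ordered by refinement. -/
def properPartitionLattice (n : ℕ) : Type :=
  {r : Setoid (Fin n) // r ≠ ⊥ ∧ r ≠ ⊤}

instance (n : ℕ) : PartialOrder (properPartitionLattice n) :=
  Subtype.partialOrder _


namespace PLW
open Classical

/-- Support of a weight function, as a finset. -/
noncomputable def supp {V : Type} [Fintype V] (w : V → ℝ) : Finset V :=
  Finset.univ.filter (fun p => w p ≠ 0)

lemma mem_supp {V : Type} [Fintype V] (w : V → ℝ) (p : V) : p ∈ supp w ↔ w p ≠ 0 := by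
  simp [supp]

/-- Geometric realization of a family of finsets. -/
def real {V : Type} [Fintype V] (K : Set (Finset V)) : Set (V → ℝ) :=
  {w | (∀ p, 0 ≤ w p) ∧ ∑ p, w p = 1 ∧ supp w ∈ K}

/-- Absolute retracts (for metric spaces). -/
def AR {E : Type} [TopologicalSpace E] (A : Set E) : Prop :=
  ∀ (Z : Type) [MetricSpace Z] (C : Set Z), IsClosed C → ∀ f : Z → E, ContinuousOn f C →
    (∀ z ∈ C, f z ∈ A) → ∃ g : Z → E, Continuous g ∧ (∀ z, g z ∈ A) ∧ ∀ z ∈ C, g z = f z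

lemma AR.union {E : Type} [TopologicalSpace E] {X₁ X₂ : Set E} (c1 : IsClosed X₁)
    (c2 : IsClosed X₂) (h1 : AR X₁) (h2 : AR X₂) (h0 : AR (X₁ ∩ X₂)) : AR (X₁ ∪ X₂) := by
  intro Z _ C hC f hf hfm
  set C₁ := C ∩ f ⁻¹' X₁ with hC₁
  set C₂ := C ∩ f ⁻¹' X₂ with hC₂
  have k1 : IsClosed C₁ := hf.preimage_isClosed_of_isClosed hC c1
  have k2 : IsClosed C₂ := hf.preimage_isClosed_of_isClosed hC c2
  have hcov : ∀ z ∈ C, z ∈ C₁ ∨ z ∈ C₂ := fun z hz => (hfm z hz).imp (fun h => ⟨hz, h⟩)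
    (fun h => ⟨hz, h⟩)
  rcases C₁.eq_empty_or_nonempty with e1 | n1
  · obtain ⟨g, g1, g2, g3⟩ := h2 Z C hC f hf (fun z hz => by
      rcases hcov z hz with h | h
      · rw [e1] at h; exact h.elim
      · exact h.2)
    exact ⟨g, g1, fun z => Or.inr (g2 z), g3⟩
  rcases C₂.eq_empty_or_nonempty with e2 | n2
  · obtain ⟨g, g1, g2, g3⟩ := h1 Z C hC f hf (fun z hz => by
      rcases hcov z hz with h | h
      · exact h.2
      · rw [e2] at h; exact h.elim)
    exact ⟨g, g1, fun z => Or.inl (g2 z), g3⟩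
  set Z₀ : Set Z := {z | Metric.infDist z C₁ = Metric.infDist z C₂} with hZ₀
  have kZ : IsClosed Z₀ := isClosed_eq (Metric.continuous_infDist_pt _)
    (Metric.continuous_infDist_pt _)
  have m1 : ∀ z, z ∈ C₁ ↔ Metric.infDist z C₁ = 0 := fun z => k1.mem_iff_infDist_zero n1
  have m2 : ∀ z, z ∈ C₂ ↔ Metric.infDist z C₂ = 0 := fun z => k2.mem_iff_infDist_zero n2
  obtain ⟨g0, g0c, g0m, g0e⟩ := h0 Z (C₁ ∩ C₂) (k1.inter k2) f
    (hf.mono (fun z hz => hz.1.1)) (fun z hz => ⟨hz.1.2, hz.2.2⟩)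
  have key : ∀ (Y : Set E) (D : Set Z), AR Y → IsClosed D → D ⊆ C → (∀ z ∈ D, f z ∈ Y) →
      (∀ z, g0 z ∈ Y) → (∀ z ∈ D, z ∈ Z₀ → g0 z = f z) →
      ∃ g : Z → E, Continuous g ∧ (∀ z, g z ∈ Y) ∧ (∀ z ∈ D, g z = f z) ∧
        ∀ z ∈ Z₀, g z = g0 z := by
    intro Y D hY hD hDC hDY hg0 hag
    obtain ⟨g, p1, p2, p3⟩ := hY Z (D ∪ Z₀) (hD.union kZ) (fun z => if z ∈ Z₀ then g0 z else f z)
      (by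
        apply ContinuousOn.union_of_isClosed _ _ hD kZ
        · refine (hf.mono hDC).congr ?_
          intro z hz
          by_cases h : z ∈ Z₀
          · simp [h, hag z hz h]
          · simp [h]
        · refine g0c.continuousOn.congr ?_
          intro z hz
          simp [hz])
      (by
        intro z hz
        by_cases h : z ∈ Z₀
        · simp [h, hg0]
        · simp only [h, if_false]
          exact hDY z (hz.resolve_right h))
    refine ⟨g, p1, p2, ?_, ?_⟩
    · intro z hz
      rw [p3 z (Or.inl hz)]
      by_cases h : z ∈ Z₀
      · simp [h, hag z hz h]
      · simp [h]
    · intro z hz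
      rw [p3 z (Or.inr hz)]
      simp [hz]
  obtain ⟨g1, q1, q2, q3, q4⟩ := key X₁ C₁ h1 k1 (fun z hz => hz.1) (fun z hz => hz.2)
    (fun z => (g0m z).1) (fun z hz hz0 => g0e z ⟨hz, by
      rw [m2]; rw [← show Metric.infDist z C₁ = Metric.infDist z C₂ from hz0]; exact (m1 z).1 hz⟩)
  obtain ⟨g2, r1, r2, r3, r4⟩ := key X₂ C₂ h2 k2 (fun z hz => hz.1) (fun z hz => hz.2)
    (fun z => (g0m z).2) (fun z hz hz0 => g0e z ⟨by
      rw [m1]; rw [show Metric.infDist z C₁ = Metric.infDist z C₂ from hz0]; exact (m2 z).1 hz, hz⟩)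
  refine ⟨fun z => if Metric.infDist z C₁ ≤ Metric.infDist z C₂ then g1 z else g2 z, ?_, ?_, ?_⟩
  · apply Continuous.if_le q1 r1 (Metric.continuous_infDist_pt _) (Metric.continuous_infDist_pt _)
    intro z hz
    rw [q4 z hz, r4 z hz]
  · intro z
    show (if _ then _ else _) ∈ _
    split_ifs
    · exact Or.inl (q2 z)
    · exact Or.inr (r2 z)
  · intro z hz
    show (if _ then _ else _) = _
    by_cases h : z ∈ C₁
    · rw [if_pos, q3 z h]
      rw [(m1 z).1 h]; exact Metric.infDist_nonneg
    · have h' := (hcov z hz).resolve_left h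
      rw [if_neg, r3 z h']
      rw [(m2 z).1 h', not_le]
      exact lt_of_le_of_ne Metric.infDist_nonneg (fun e => h ((m1 z).2 e.symm))

lemma AR.simplex {V : Type} [Fintype V] (s : Finset V) (hs : s.Nonempty) :
    AR (real {t | t ⊆ s}) := by
  intro Z _ C hC f hf hfm
  obtain ⟨F, hF⟩ := ContinuousMap.exists_restrict_eq (Y := V → ℝ) hC
    ⟨C.domRestrict f, continuousOn_iff_continuous_domRestrict.1 hf⟩
  have hFe : ∀ z ∈ C, F z = f z := fun z hz => by
    exact DFunLike.congr_fun hF ⟨z, hz⟩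
  set y : Z → V → ℝ := fun z p => if p ∈ s then max (F z p) 0 else 0 with hy
  have ycont : ∀ p, Continuous fun z => y z p := by
    intro p
    by_cases h : p ∈ s
    · simp only [hy, h, if_true]; fun_prop
    · simp only [hy, h, if_false]; fun_prop
  have ynn : ∀ z p, 0 ≤ y z p := by
    intro z p; simp only [hy]; split_ifs <;> simp
  set S : Z → ℝ := fun z => ∑ p, y z p with hS
  have Scont : Continuous S := by simp only [hS]; exact continuous_finsetSum _ (fun p _ => ycont p)
  have hcard : (0:ℝ) < s.card := by exact_mod_cast hs.card_pos
  set x : Z → V → ℝ := fun z p => y z p + if p ∈ s then max 0 (1 - S z) / s.card else 0 with hx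
  have xnn : ∀ z p, 0 ≤ x z p := by
    intro z p; simp only [hx]
    have := ynn z p
    split_ifs <;> positivity
  have xsum : ∀ z, ∑ p, x z p = max (S z) 1 := by
    intro z
    simp only [hx, Finset.sum_add_distrib, Finset.sum_ite_mem, Finset.univ_inter,
      Finset.sum_const, nsmul_eq_mul]
    rw [mul_div_cancel₀ _ hcard.ne']
    show S z + _ = _
    rcases le_total (S z) 1 with h | h
    · rw [max_eq_right (by linarith), max_eq_right h]; ring
    · rw [max_eq_left (by linarith), max_eq_left h]; ring
  have xpos : ∀ z, 0 < max (S z) 1 := fun z => lt_max_of_lt_right one_pos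
  refine ⟨fun z p => x z p / max (S z) 1, ?_, ?_, ?_⟩
  · refine continuous_pi fun p => Continuous.div ?_ (by fun_prop) (fun z => (xpos z).ne')
    by_cases h : p ∈ s
    · simp only [hx, h, if_true]
      exact (ycont p).add (by fun_prop)
    · simp only [hx, h, if_false]
      exact (ycont p).add (by fun_prop)
  · intro z
    refine ⟨fun p => div_nonneg (xnn z p) (xpos z).le, ?_, ?_⟩
    · rw [← Finset.sum_div, xsum, div_self (xpos z).ne']
    · intro p hp
      by_contra hps
      rw [mem_supp] at hp
      apply hp
      simp [hx, hy, hps]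
  · intro z hz
    have h := hfm z hz
    have e1 : y z = f z := by
      ext p
      simp only [hy, hFe z hz]
      split_ifs with hp
      · exact max_eq_left (h.1 p)
      · by_contra hne
        exact hp (h.2.2 ((mem_supp _ _).2 (Ne.symm hne)))
    have e2 : S z = 1 := by simp only [hS, e1]; exact h.2.1
    ext p
    simp [hx, e2, e1]

/-- Complexes glued from simplices along complexes of the same sort. -/
inductive Coll {V : Type} : Set (Finset V) → Prop
  | simplex (s : Finset V) (hs : s.Nonempty) : Coll {t | t ⊆ s}
  | glue (K L : Set (Finset V)) : Coll K → Coll L → Coll (K ∩ L) → Coll (K ∪ L)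

def Down {V : Type} (K : Set (Finset V)) : Prop := ∀ s ∈ K, ∀ t, t ⊆ s → t ∈ K

lemma Coll.down {V : Type} {K : Set (Finset V)} (h : Coll K) : Down K := by
  induction h with
  | simplex s hs => exact fun a ha b hb => hb.trans ha
  | glue K L _ _ _ h1 h2 h3 =>
    intro a ha b hb
    rcases ha with h | h
    · exact Or.inl (h1 a h b hb)
    · exact Or.inr (h2 a h b hb)

lemma isClosed_real {V : Type} [Fintype V] {K : Set (Finset V)} (h : Down K) :
    IsClosed (real K) := by
  have : real K = ⋃ t ∈ K, {w : V → ℝ | (∀ p, 0 ≤ w p) ∧ ∑ p, w p = 1 ∧ ∀ p, p ∉ t → w p = 0} := by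
    ext w
    simp only [Set.mem_iUnion, Set.mem_ofPred_eq]
    constructor
    · rintro ⟨h1, h2, h3⟩
      exact ⟨supp w, h3, h1, h2, fun p hp => by simpa [mem_supp] using hp⟩
    · rintro ⟨t, ht, h1, h2, h3⟩
      refine ⟨h1, h2, h t ht _ ?_⟩
      intro p hp
      by_contra hpt
      exact (mem_supp _ _).1 hp (h3 p hpt)
  rw [this]
  refine (Set.toFinite K).isClosed_biUnion fun t _ => ?_
  refine IsClosed.inter ?_ (IsClosed.inter ?_ ?_)
  · show IsClosed {w : V → ℝ | ∀ p, 0 ≤ w p}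
    simp only [Set.ofPred_forall]
    exact isClosed_iInter fun p => isClosed_le continuous_const (continuous_apply p)
  · exact isClosed_eq (by fun_prop) continuous_const
  · show IsClosed {w : V → ℝ | ∀ p, p ∉ t → w p = 0}
    simp only [Set.ofPred_forall]
    exact isClosed_iInter fun p => isClosed_iInter fun _ =>
      isClosed_eq (continuous_apply p) continuous_const

lemma isCompact_real {V : Type} [Fintype V] {K : Set (Finset V)} (h : Down K) :
    IsCompact (real K) := by
  refine IsCompact.of_isClosed_subset (isCompact_univ_pi (fun _ : V => isCompact_Icc (a := (0:ℝ))
    (b := 1))) (isClosed_real h) ?_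
  intro w hw p _
  refine ⟨hw.1 p, ?_⟩
  rw [← hw.2.1]
  exact Finset.single_le_sum (fun q _ => hw.1 q) (Finset.mem_univ p)

lemma Coll.ar {V : Type} [Fintype V] {K : Set (Finset V)} (h : Coll K) : AR (real K) := by
  induction h with
  | simplex s hs => exact AR.simplex s hs
  | glue K L hK hL hKL h1 h2 h3 =>
    have e1 : real (K ∪ L) = real K ∪ real L := by
      ext w; simp only [real, Set.mem_union, Set.mem_ofPred_eq]; tauto
    have e2 : real (K ∩ L) = real K ∩ real L := by
      ext w; simp only [real, Set.mem_inter_iff, Set.mem_ofPred_eq]; tauto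
    rw [e1]
    rw [e2] at h3
    exact AR.union (isClosed_real hK.down) (isClosed_real hL.down) h1 h2 h3

lemma AR.contract {E : Type} [NormedAddCommGroup E] [NormedSpace ℝ E] {A : Set E} (h : AR A)
    (hA : IsClosed A) : ∃ a₀ ∈ A, ∃ k : E × ℝ → E, Continuous k ∧ (∀ z, k z ∈ A) ∧
      (∀ x ∈ A, k (x, 0) = x) ∧ ∀ x ∈ A, k (x, 1) = a₀ := by
  obtain ⟨g, -, hg, -⟩ := h ℝ ∅ isClosed_empty (fun _ => 0) (by simp) (by simp)
  refine ⟨g 0, hg 0, ?_⟩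
  obtain ⟨k, k1, k2, k3⟩ := h (E × ℝ) (A ×ˢ {0, 1})
    (hA.prod (Set.toFinite _).isClosed) (fun z => (1 - z.2) • z.1 + z.2 • g 0)
    (by fun_prop) (by
      rintro ⟨x, t⟩ ⟨hx, ht⟩
      rcases ht with ht | ht
      · simp only at ht; subst ht; simpa using hx
      · simp only [Set.mem_singleton_iff] at ht; subst ht; simpa using hg 0)
  refine ⟨k, k1, k2, ?_, ?_⟩
  · intro x hx
    rw [k3 _ ⟨hx, by simp⟩]; simp
  · intro x hx
    rw [k3 _ ⟨hx, by simp⟩]; simp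
end PLW

open Function
namespace PLW
open Classical

lemma erase_sub {V : Type} {a : V} {s t : Finset V} : s.erase a ⊆ t ↔ s ⊆ insert a t :=
  Finset.subset_insert_iff.symm

lemma Coll.cone {V : Type} {K : Set (Finset V)} (h : Coll K) (v : V) :
    Coll {t | t.erase v ∈ K} := by
  induction h with
  | simplex s hs =>
    have : {t : Finset V | t.erase v ∈ {t | t ⊆ s}} = {t | t ⊆ insert v s} := by
      ext t
      exact erase_sub
    rw [this]
    exact Coll.simplex _ (Finset.insert_nonempty _ _)
  | glue K L _ _ _ h1 h2 h3 => exact Coll.glue _ _ h1 h2 h3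

lemma Coll.map {V W : Type} (f : V ↪ W) {K : Set (Finset V)} (h : Coll K) :
    Coll (Finset.map f '' K) := by
  induction h with
  | simplex s hs =>
    have : Finset.map f '' {t | t ⊆ s} = {t | t ⊆ s.map f} := by
      ext t
      constructor
      · rintro ⟨a, ha, rfl⟩
        exact Finset.map_subset_map.2 ha
      · intro ht
        obtain ⟨a, ha, rfl⟩ := Finset.subset_map_iff.1 ht
        exact ⟨a, ha, rfl⟩
    rw [this]
    exact Coll.simplex _ (by simpa using hs)
  | glue K L _ _ _ h1 h2 h3 =>
    rw [Set.image_inter (Finset.map_injective f)] at h3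
    rw [Set.image_union]
    exact Coll.glue _ _ h1 h2 h3

/-- Cones are collapsible. -/
lemma Coll.of_cone_aux {V : Type} [Fintype V] (v : V) (n : ℕ) : ∀ (K : Set (Finset V)), Down K →
    ∅ ∈ K → K.ncard = n → Coll {t | t.erase v ∈ K} := by
  induction n using Nat.strong_induction_on with
  | _ n ih =>
    intro K hK h0 hn
    by_cases hKe : K = {∅}
    · have : {t : Finset V | t.erase v ∈ K} = {t | t ⊆ {v}} := by
        ext t
        simp only [hKe, Set.mem_ofPred_eq, Set.mem_singleton_iff]
        rw [Finset.erase_eq_empty_iff, Finset.subset_singleton_iff]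
      rw [this]
      exact Coll.simplex _ (Finset.singleton_nonempty v)
    · obtain ⟨s, hs⟩ := (Set.toFinite K).exists_maximal ⟨∅, h0⟩
      have hsne : s ≠ ∅ := by
        rintro rfl
        apply hKe
        ext t
        constructor
        · intro ht
          exact Finset.subset_empty.1 (hs.2 ht (Finset.empty_subset t))
        · rintro rfl; exact h0
      have e1 : {t : Finset V | t.erase v ∈ K} =
          {t | t.erase v ∈ K \ {s}} ∪ {t | t ⊆ insert v s} := by
        ext t
        simp only [Set.mem_ofPred_eq, Set.mem_union, Set.mem_sdiff, Set.mem_singleton_iff,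
          ← erase_sub]
        constructor
        · intro h
          by_cases e : t.erase v = s
          · exact Or.inr e.le
          · exact Or.inl ⟨h, e⟩
        · rintro (h | h)
          · exact h.1
          · exact hK s hs.1 _ h
      have e2 : {t : Finset V | t.erase v ∈ K \ {s}} ∩ {t | t ⊆ insert v s} =
          {t | t.erase v ∈ {t | t ⊂ s}} := by
        ext t
        simp only [Set.mem_ofPred_eq, Set.mem_inter_iff, Set.mem_sdiff, Set.mem_singleton_iff,
          ← erase_sub]
        constructor
        · rintro ⟨⟨_, h2⟩, h3⟩
          exact lt_of_le_of_ne h3 h2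
        · intro h
          exact ⟨⟨hK s hs.1 _ h.1, ne_of_lt h⟩, h.1⟩
      have lt1 : (K \ {s}).ncard < n := by
        rw [← hn]; exact Set.ncard_sdiff_singleton_lt_of_mem hs.1
      have lt2 : ({t | t ⊂ s} : Set (Finset V)).ncard < n := by
        refine lt_of_le_of_lt (Set.ncard_le_ncard ?_ (Set.toFinite _)) lt1
        intro t ht
        exact ⟨hK s hs.1 _ ht.1, ne_of_lt ht⟩
      rw [e1]
      refine Coll.glue _ _ ?_ (Coll.simplex _ (Finset.insert_nonempty _ _)) ?_
      · refine ih _ lt1 _ ?_ ⟨h0, Ne.symm hsne⟩ rfl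
        rintro a ⟨ha, ha'⟩ b hb
        refine ⟨hK a ha b hb, ?_⟩
        rintro rfl
        exact ha' (hs.eq_of_le ha hb).symm
      · rw [e2]
        refine ih _ lt2 _ ?_ ?_ rfl
        · intro a ha b hb
          exact lt_of_le_of_lt hb ha
        · exact Finset.empty_ssubset.2 (Finset.nonempty_iff_ne_empty.2 hsne)

lemma Coll.of_cone {V : Type} [Fintype V] (v : V) (K : Set (Finset V)) (hK : Down K)
    (h0 : ∅ ∈ K) (hv : ∀ t ∈ K, insert v t ∈ K) : Coll K := by
  have := Coll.of_cone_aux v _ K hK h0 rfl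
  convert this using 1
  ext t
  constructor
  · intro h; exact hK t h _ (Finset.erase_subset _ _)
  · intro h
    exact hK _ (hv _ h) _ (erase_sub.1 le_rfl)

/-- Chains contained in a set. -/
def chains {P : Type} [PartialOrder P] (S : Set P) : Set (Finset P) :=
  {t | (t : Set P) ⊆ S ∧ IsChain (· ≤ ·) (t : Set P)}

lemma chains_down {P : Type} [PartialOrder P] (S : Set P) : Down (chains S) := by
  rintro s ⟨h1, h2⟩ t ht
  have ht' : (t : Set P) ⊆ s := by exact_mod_cast ht
  exact ⟨ht'.trans h1, h2.mono ht'⟩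

lemma coll_conical {P : Type} [Fintype P] [PartialOrder P] (S : Set P) (a : P) (ha : a ∈ S)
    (m : P → P) (hm : ∀ r ∈ S, ¬ r ≤ a → m r ∈ S ∧ m r ≤ a ∧ m r < r ∧
      ∀ s ∈ S, s ≤ a → s < r → s ≤ m r) : Coll (chains S) := by
  have key : ∀ n : ℕ, ∀ T : Finset P, T.card = n → (∀ r ∈ T, r ∈ S ∧ ¬ r ≤ a) →
      Coll (chains ({s | s ∈ S ∧ s ≤ a} ∪ (T : Set P))) := by
    intro n
    induction n with
    | zero =>
      intro T hT _
      rw [Finset.card_eq_zero] at hT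
      subst hT
      refine Coll.of_cone a _ (chains_down _) ⟨by simp, by simp⟩ ?_
      rintro t ⟨h1, h2⟩
      simp only [Finset.coe_empty, Set.union_empty] at h1 ⊢
      refine ⟨?_, ?_⟩
      · rw [Finset.coe_insert, Set.insert_subset_iff]
        exact ⟨⟨ha, le_rfl⟩, h1⟩
      · rw [Finset.coe_insert]
        exact h2.insert (fun b hb _ => Or.inr (h1 hb).2)
    | succ n ih =>
      intro T hT hTS
      obtain ⟨r, hr⟩ := T.exists_minimal (Finset.card_pos.1 (by omega))
      obtain ⟨hrS, hra⟩ := hTS r hr.1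
      obtain ⟨m1, m2, m3, m4⟩ := hm r hrS hra
      set Q : Set P := {s | s ∈ S ∧ s ≤ a} ∪ ((T.erase r : Finset P) : Set P) with hQ
      have hrQ : r ∉ Q := by
        rintro (h | h)
        · exact hra h.2
        · simp at h
      have hQ' : {s | s ∈ S ∧ s ≤ a} ∪ (T : Set P) = insert r Q := by
        have : (T : Set P) = insert r ((T.erase r : Finset P) : Set P) := by
          rw [← Finset.coe_insert, Finset.insert_erase hr.1]
        rw [this, hQ, Set.union_insert]
      have hIH : Coll (chains Q) := ih (T.erase r) (by rw [Finset.card_erase_of_mem hr.1]; omega)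
        (fun x hx => hTS x (Finset.mem_of_mem_erase hx))
      set L : Set (Finset P) := {t | t ∈ chains Q ∧ ∀ x ∈ t, x ≤ r ∨ r ≤ x} with hL
      have hLd : Down L := by
        rintro s ⟨h1, h2⟩ t ht
        exact ⟨chains_down _ s h1 t ht, fun x hx => h2 x (ht hx)⟩
      have hmQ : m r ∈ Q := Or.inl ⟨m1, m2⟩
      have hLc : Coll L := by
        refine Coll.of_cone (m r) L hLd ⟨⟨by simp, by simp⟩, by simp⟩ ?_
        rintro t ⟨⟨h1, h2⟩, h3⟩
        refine ⟨⟨?_, ?_⟩, ?_⟩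
        · rw [Finset.coe_insert, Set.insert_subset_iff]
          exact ⟨hmQ, h1⟩
        · rw [Finset.coe_insert]
          refine h2.insert (fun b hb _ => ?_)
          rcases h3 b hb with h | h
          · right
            have hbr : b ≠ r := by rintro rfl; exact hrQ (h1 hb)
            rcases h1 hb with h' | h'
            · exact m4 b h'.1 h'.2 (lt_of_le_of_ne h hbr)
            · exfalso
              have hbT : b ∈ T := Finset.mem_of_mem_erase (Finset.mem_coe.1 h')
              exact hbr (hr.eq_of_ge hbT h).symm
          · exact Or.inl (m3.le.trans h)
        · intro x hx
          rcases Finset.mem_insert.1 hx with rfl | hx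
          · exact Or.inl m3.le
          · exact h3 x hx
      have e1 : chains (insert r Q) = chains Q ∪ {t | t.erase r ∈ L} := by
        ext t
        constructor
        · rintro ⟨h1, h2⟩
          by_cases hrt : r ∈ t
          · right
            refine ⟨⟨?_, ?_⟩, ?_⟩
            · intro x hx
              rw [Finset.mem_coe, Finset.mem_erase] at hx
              exact (h1 hx.2).resolve_left hx.1
            · exact h2.mono (by exact_mod_cast Finset.erase_subset _ _)
            · intro x hx
              exact h2.total (Finset.mem_of_mem_erase hx) hrt
          · left
            refine ⟨fun x hx => (h1 hx).resolve_left ?_, h2⟩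
            rintro rfl
            exact hrt hx
        · rintro (⟨h1, h2⟩ | ⟨⟨h1, h2⟩, h3⟩)
          · exact ⟨h1.trans (Set.subset_insert _ _), h2⟩
          · refine chains_down _ (insert r (t.erase r)) ⟨?_, ?_⟩ t
              (erase_sub.1 le_rfl)
            · rw [Finset.coe_insert]
              exact Set.insert_subset_insert h1
            · rw [Finset.coe_insert]
              exact h2.insert (fun b hb _ => (h3 b hb).symm)
      have e2 : chains Q ∩ {t | t.erase r ∈ L} = L := by
        ext t
        constructor
        · rintro ⟨h1, h2⟩
          have : r ∉ t := fun h => hrQ (h1.1 h)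
          simpa [Finset.erase_eq_of_notMem this] using h2
        · intro h
          exact ⟨h.1, hLd t h _ (Finset.erase_subset _ _)⟩
      rw [hQ', e1]
      refine Coll.glue _ _ hIH (hLc.cone r) ?_
      rw [e2]; exact hLc
  have := key _ (Finset.univ.filter (fun r => r ∈ S ∧ ¬ r ≤ a)) rfl (by simp)
  convert this using 2
  ext x
  simp only [Finset.coe_filter, Finset.mem_univ, true_and, Set.mem_union, Set.mem_ofPred_eq]
  tauto

/-- Combinatorial sphericity: after removing `N` facets of size `k`, what is left is void or
collapsible. -/
def Sph (P : Type) [PartialOrder P] (k N : ℕ) : Prop :=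
  ∃ F : Set (Finset P), F.Finite ∧ F.ncard = N ∧ (∀ t ∈ F, t.card = k ∧ t ∈ chains (Set.univ : Set P) ∧
    ∀ s ∈ chains (Set.univ : Set P), t ⊆ s → s = t) ∧
    (chains (Set.univ : Set P) \ F = ∅ ∨ Coll (chains (Set.univ : Set P) \ F))

/-- Transport of sphericity to a subset of a bigger poset. -/
lemma Sph.on {P Q : Type} [PartialOrder P] [PartialOrder Q] {k N : ℕ} (h : Sph P k N)
    (S : Set Q) (e : P ≃o S) :
    ∃ F : Set (Finset Q), F.Finite ∧ F.ncard = N ∧ (∀ t ∈ F, t.card = k ∧ t ∈ chains S ∧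
      ∀ s ∈ chains S, t ⊆ s → s = t) ∧ (chains S \ F = ∅ ∨ Coll (chains S \ F)) := by
  obtain ⟨F, F0, F1, F2, F3⟩ := h
  let f : P ↪ Q := e.toEquiv.toEmbedding.trans (Embedding.subtype _)
  have hfS : ∀ x, f x ∈ S := fun x => (e x).2
  have hfle : ∀ x y, f x ≤ f y ↔ x ≤ y := fun x y => e.le_iff_le
  have hfs : ∀ y ∈ S, ∃ x, f x = y := fun y hy => ⟨e.symm ⟨y, hy⟩, by simp [f]⟩
  have hch : ∀ t : Finset P, t ∈ chains Set.univ ↔ t.map f ∈ chains S := by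
    intro t
    constructor
    · rintro ⟨-, h⟩
      refine ⟨?_, ?_⟩
      · intro y hy
        obtain ⟨x, -, rfl⟩ := Finset.mem_map.1 (Finset.mem_coe.1 hy)
        exact hfS x
      · intro a ha b hb hab
        obtain ⟨x, hx, rfl⟩ := Finset.mem_map.1 (Finset.mem_coe.1 ha)
        obtain ⟨y, hy, rfl⟩ := Finset.mem_map.1 (Finset.mem_coe.1 hb)
        exact (h.total hx hy).imp (hfle _ _).2 (hfle _ _).2
    · rintro ⟨-, h⟩
      refine ⟨by simp, ?_⟩
      intro a ha b hb hab
      exact (h.total (Finset.mem_coe.2 (Finset.mem_map_of_mem f ha))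
        (Finset.mem_coe.2 (Finset.mem_map_of_mem f hb))).imp (hfle _ _).1 (hfle _ _).1
  have hsurj : ∀ s ∈ chains S, ∃ t, t ∈ chains (Set.univ : Set P) ∧ t.map f = s := by
    intro s hs
    have : (s : Set Q) ⊆ Set.range f := fun y hy => hfs y (hs.1 hy)
    obtain ⟨t, ht⟩ : ∃ t : Finset P, t.map f = s := by
      refine ⟨s.preimage f f.injective.injOn, ?_⟩
      ext y
      simp only [Finset.mem_map, Finset.mem_preimage]
      constructor
      · rintro ⟨x, hx, rfl⟩; exact hx
      · intro hy
        obtain ⟨x, rfl⟩ := this hy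
        exact ⟨x, hy, rfl⟩
    exact ⟨t, (hch t).2 (ht ▸ hs), ht⟩
  have eimg : chains S \ (Finset.map f '' F) = Finset.map f '' (chains Set.univ \ F) := by
    rw [Set.image_sdiff (Finset.map_injective f)]
    congr 1
    ext s
    constructor
    · intro hs
      obtain ⟨t, h1, h2⟩ := hsurj s hs
      exact ⟨t, h1, h2⟩
    · rintro ⟨t, h1, rfl⟩
      exact (hch t).1 h1
  refine ⟨Finset.map f '' F, F0.image _, ?_, ?_, ?_⟩
  · rw [Set.ncard_image_of_injective _ (Finset.map_injective f), F1]
  · rintro _ ⟨t, ht, rfl⟩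
    obtain ⟨h1, h2, h3⟩ := F2 t ht
    refine ⟨by rw [Finset.card_map, h1], (hch t).1 h2, ?_⟩
    intro s hs hts
    obtain ⟨s', hs', rfl⟩ := hsurj s hs
    rw [h3 s' hs' (Finset.map_subset_map.1 hts)]
  · rw [eimg]
    rcases F3 with h | h
    · left; rw [h, Set.image_empty]
    · right; exact h.map f

/-- Inductive step: adding an antichain of minimal elements to a conical poset. -/
lemma Sph.step {P : Type} [Fintype P] [PartialOrder P] {M k N : ℕ} (y : Fin M → P)
    (hy : Injective y) (hmin : ∀ i, IsMin (y i))
    (hS : Coll (chains ((Set.range y)ᶜ)))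
    (hlink : ∀ i, ∃ (Q : Type) (_ : PartialOrder Q), Sph Q k N ∧
      Nonempty (Q ≃o {x | y i < x})) : Sph P (k + 1) (M * N) := by
  have : ∀ i, ∃ F : Set (Finset P), F.Finite ∧ F.ncard = N ∧
      (∀ t ∈ F, t.card = k ∧ t ∈ chains {x | y i < x} ∧
      ∀ s ∈ chains {x | y i < x}, t ⊆ s → s = t) ∧
      (chains {x | y i < x} \ F = ∅ ∨ Coll (chains {x | y i < x} \ F)) := by
    intro i
    obtain ⟨Q, _, h1, ⟨e⟩⟩ := hlink i
    exact h1.on _ e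
  choose F F0 F1 F2 F3 using this
  have yn : ∀ i t, t ∈ chains {x | y i < x} → ∀ j, y j ∉ t := by
    intro i t ht j hj
    exact (hmin j).not_lt (ht.1 hj)
  have hins : ∀ i t, t ∈ chains {x | y i < x} → insert (y i) t ∈ chains (Set.univ : Set P) := by
    intro i t ht
    refine ⟨by simp, ?_⟩
    rw [Finset.coe_insert]
    exact ht.2.insert (fun b hb _ => Or.inl (ht.1 hb).le)
  have hers : ∀ i t, t ∈ chains (Set.univ : Set P) → y i ∈ t → t.erase (y i) ∈ chains {x | y i < x} := by
    intro i t ht hi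
    refine ⟨?_, ht.2.mono (by exact_mod_cast Finset.erase_subset _ _)⟩
    intro x hx
    rw [Finset.mem_coe, Finset.mem_erase] at hx
    rcases ht.2.total hi hx.2 with h | h
    · exact lt_of_le_of_ne h hx.1.symm
    · exact (hx.1 ((hmin i).eq_of_le h)).elim
  -- only one of the minimal elements lies in a chain
  have hone : ∀ i j t, t ∈ chains {x | y i < x} → y j ∈ insert (y i) t → j = i := by
    intro i j t ht hj
    rcases Finset.mem_insert.1 hj with h | h
    · exact hy h
    · exact (yn i t ht j h).elim
  set G : Fin M → Set (Finset P) := fun i => insert (y i) '' F i with hG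
  have Gcard : ∀ i, (G i).ncard = N := by
    intro i
    rw [← F1 i]
    refine Set.InjOn.ncard_image ?_
    intro s hs t ht hst
    have h1 := yn i s (F2 i s hs).2.1 i
    have h2 := yn i t (F2 i t ht).2.1 i
    rw [← Finset.erase_insert h1, ← Finset.erase_insert h2, hst]
  have memG : ∀ i t, t ∈ G i → y i ∈ t ∧ t.erase (y i) ∈ F i := by
    rintro i _ ⟨t, ht, rfl⟩
    refine ⟨Finset.mem_insert_self _ _, ?_⟩
    rw [Finset.erase_insert (yn i t (F2 i t ht).2.1 i)]
    exact ht
  have memG' : ∀ i t, y i ∈ t → t.erase (y i) ∈ F i → t ∈ G i := fun i t h1 h2 =>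
    ⟨_, h2, Finset.insert_erase h1⟩
  have Gone : ∀ i j t, t ∈ G i → y j ∈ t → j = i := by
    rintro i j _ ⟨t, ht, rfl⟩ hj
    exact hone i j t (F2 i t ht).2.1 hj
  have Gfin : ∀ i, (G i).Finite := fun i => (F0 i).image _
  refine ⟨⋃ i, G i, Set.finite_iUnion Gfin, ?_, ?_, ?_⟩
  · have hdis : Pairwise (Disjoint on G) := by
      intro i j hij
      refine Set.disjoint_left.2 fun t h1 h2 => hij ?_
      exact Gone j i t h2 (memG i t h1).1
    rw [Set.ncard_iUnion_of_finite Gfin hdis]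
    simp [finsum_eq_sum_of_fintype, Gcard]
  · intro t ht
    obtain ⟨i, hi⟩ := Set.mem_iUnion.1 ht
    obtain ⟨h1, h2⟩ := memG i t hi
    obtain ⟨f1, f2, f3⟩ := F2 i _ h2
    refine ⟨?_, ?_, ?_⟩
    · rw [← Finset.card_erase_add_one h1, f1]
    · rw [← Finset.insert_erase h1]; exact hins i _ f2
    · intro s hs hts
      have := f3 (s.erase (y i)) (hers i s hs (hts h1)) (Finset.erase_subset_erase _ hts)
      rw [← Finset.insert_erase h1, ← this, Finset.insert_erase (hts h1)]
  · right
    have key : ∀ T : Finset (Fin M), Coll (chains ((Set.range y)ᶜ) ∪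
        ⋃ i ∈ T, {t | t.erase (y i) ∈ chains {x | y i < x} \ F i}) := by
      intro T
      induction T using Finset.induction_on with
      | empty => simpa using hS
      | insert i T hi ih =>
        rw [Finset.set_biUnion_insert, Set.union_comm {t | _}, ← Set.union_assoc]
        rcases F3 i with h | h
        · have : {t : Finset P | t.erase (y i) ∈ chains {x | y i < x} \ F i} = ∅ := by
            rw [h]; rfl
          rw [this, Set.union_empty]
          exact ih
        · refine Coll.glue _ _ ih (h.cone (y i)) ?_
          convert h using 1
          ext t
          constructor
          · rintro ⟨h1, h2⟩
            have : y i ∉ t := by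
              intro hit
              rcases h1 with h1 | h1
              · exact h1.1 hit ⟨i, rfl⟩
              · simp only [Set.mem_iUnion] at h1
                obtain ⟨j, hj, h1⟩ := h1
                have hij : i ≠ j := by rintro rfl; exact hi hj
                refine yn j _ h1.1 i (Finset.mem_erase.2 ⟨fun e => hij (hy e), hit⟩)
            simpa [Finset.erase_eq_of_notMem this] using h2
          · intro ht
            have hyt := yn i t ht.1
            refine ⟨Or.inl ⟨?_, ht.1.2⟩, ?_⟩
            · rintro x hx ⟨j, rfl⟩
              exact hyt j hx
            · simpa [Finset.erase_eq_of_notMem (hyt i)] using ht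
    convert key Finset.univ using 1
    ext t
    simp only [Set.mem_sdiff, Set.mem_iUnion, Set.mem_union, Finset.mem_univ, exists_prop, true_and,
      Set.mem_ofPred_eq]
    constructor
    · rintro ⟨h1, h2⟩
      by_cases h : ∃ i, y i ∈ t
      · obtain ⟨i, hi⟩ := h
        exact Or.inr ⟨i, hers i t h1 hi, fun hF => h2 ⟨i, memG' i t hi hF⟩⟩
      · left
        refine ⟨?_, h1.2⟩
        rintro x hx ⟨i, rfl⟩
        exact h ⟨i, hx⟩
    · rintro (h | ⟨i, h1, h2⟩)
      · refine ⟨⟨by simp, h.2⟩, ?_⟩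
        rintro ⟨i, hi⟩
        exact h.1 (memG i t hi).1 ⟨i, rfl⟩
      · refine ⟨chains_down _ _ (hins i _ h1) t (erase_sub.1 le_rfl), ?_⟩
        rintro ⟨j, hj⟩
        have h3 := memG j t hj
        have : j = i := by
          by_contra hne
          exact yn i _ h1 j (Finset.mem_erase.2 ⟨fun e => hne (hy e), h3.1⟩)
        subst this
        exact h2 h3.2
end PLW

open Function
namespace PLW
open Classical

lemma hequiv_of_collapse {X W : Type} [TopologicalSpace X] [TopologicalSpace W] [CompactSpace X]
    [T2Space W] (f : X → W) (hf : Continuous f) (hs : Surjective f) (A : Set X)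
    (hA : ∀ x y, f x = f y → x = y ∨ (x ∈ A ∧ y ∈ A)) (hA' : ∀ x ∈ A, ∀ y ∈ A, f x = f y)
    (G : X × unitInterval → X) (hG : Continuous G) (h0 : ∀ x, G (x, 0) = x)
    (hGA : ∀ x ∈ A, ∀ t, G (x, t) ∈ A) (h1 : ∀ x ∈ A, ∀ y ∈ A, G (x, 1) = G (y, 1)) :
    Nonempty (ContinuousMap.HomotopyEquiv X W) := by
  have q1 : Topology.IsQuotientMap f := hf.isClosedMap.isQuotientMap hf hs
  have hf2 : Continuous (Prod.map f (id : unitInterval → unitInterval)) := by fun_prop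
  have hs2 : Surjective (Prod.map f (id : unitInterval → unitInterval)) :=
    hs.prodMap surjective_id
  have q2 : Topology.IsQuotientMap (Prod.map f (id : unitInterval → unitInterval)) :=
    hf2.isClosedMap.isQuotientMap hf2 hs2
  set r := surjInv hs with hr
  have hfr : ∀ w, f (r w) = w := surjInv_eq hs
  have hg : Continuous (fun w => G (r w, 1)) := by
    rw [q1.continuous_iff]
    have : (fun w => G (r w, 1)) ∘ f = fun x => G (x, 1) := by
      ext x
      show G (r (f x), 1) = _
      rcases hA _ _ (hfr (f x)) with h | h
      · rw [h]
      · exact h1 _ h.1 _ h.2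
    rw [this]; fun_prop
  have hgf : ∀ x, G (r (f x), 1) = G (x, 1) := by
    intro x
    rcases hA _ _ (hfr (f x)) with h | h
    · rw [h]
    · exact h1 _ h.1 _ h.2
  have hH : Continuous (fun z : W × unitInterval => f (G (r z.1, z.2))) := by
    rw [q2.continuous_iff]
    have : (fun z : W × unitInterval => f (G (r z.1, z.2))) ∘ Prod.map f id = fun z => f (G z) := by
      ext ⟨x, t⟩
      show f (G (r (f x), t)) = f (G (x, t))
      rcases hA _ _ (hfr (f x)) with h | h
      · rw [h]
      · exact hA' _ (hGA _ h.1 _) _ (hGA _ h.2 _)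
    rw [this]; fun_prop
  refine ⟨⟨⟨f, hf⟩, ⟨_, hg⟩, ?_, ?_⟩⟩
  · refine ContinuousMap.Homotopic.symm ⟨⟨⟨fun z => G (z.2, z.1), by fun_prop⟩, ?_, ?_⟩⟩
    · intro x; exact h0 x
    · intro x; exact (hgf x).symm
  · refine ContinuousMap.Homotopic.symm ⟨⟨⟨fun z => f (G (r z.2, z.1)),
      hH.comp (continuous_snd.prodMk continuous_fst)⟩, ?_, ?_⟩⟩
    · intro w
      show f (G (r w, 0)) = w
      rw [h0, hfr]
    · intro w; rfl

section wedge
variable {ι : Type} {Y : ι → Type} [∀ i, TopologicalSpace (Y i)] (y₀ : ∀ i, Y i)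

/-- Inclusion of a wedge summand. -/
def wmk (i : ι) (y : Y i) : Wedge Y y₀ := Quot.mk _ ⟨i, y⟩

lemma continuous_wmk (i : ι) : Continuous (wmk y₀ i) :=
  continuous_quot_mk.comp continuous_sigmaMk

lemma wmk_base (i j : ι) : wmk y₀ i (y₀ i) = wmk y₀ j (y₀ j) :=
  Quot.sound (Or.inr ⟨rfl, rfl⟩)

/-- Projection of the wedge to a summand. -/
noncomputable def wproj (i : ι) : Wedge Y y₀ → Y i :=
  Quot.lift (fun a => if h : a.1 = i then h ▸ a.2 else y₀ i) (by
    rintro ⟨a, x⟩ ⟨b, y⟩ (h | ⟨h1, h2⟩)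
    · rw [h]
    · simp only at h1 h2
      subst h1 h2
      have : ∀ c : ι, (if h : c = i then (h ▸ y₀ c : Y i) else y₀ i) = y₀ i := by
        intro c
        split_ifs with h
        · subst h; rfl
        · rfl
      simp only [this])

lemma wproj_same (i : ι) (y : Y i) : wproj y₀ i (wmk y₀ i y) = y := by
  simp [wproj, wmk]

lemma wproj_ne (i j : ι) (h : j ≠ i) (y : Y j) : wproj y₀ i (wmk y₀ j y) = y₀ i := by
  simp [wproj, wmk, h]

lemma continuous_wproj (i : ι) : Continuous (wproj y₀ i) := by
  refine continuous_quot_lift _ ?_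
  rw [continuous_sigma_iff]
  intro j
  by_cases h : j = i
  · subst h; simp only [dif_pos]; exact continuous_id
  · simp only [h, dif_neg, not_false_eq_true]; exact continuous_const

lemma wmk_surj (w : Wedge Y y₀) : ∃ i y, w = wmk y₀ i y := by
  induction w using Quot.ind with
  | mk a => exact ⟨a.1, a.2, rfl⟩

lemma wproj_inj (v w : Wedge Y y₀) (h : ∀ i, wproj y₀ i v = wproj y₀ i w) : v = w := by
  obtain ⟨i, x, rfl⟩ := wmk_surj y₀ v
  obtain ⟨j, y, rfl⟩ := wmk_surj y₀ w
  by_cases hij : j = i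
  · subst hij
    have := h j
    rw [wproj_same, wproj_same] at this
    rw [this]
  · have a := h i
    have b := h j
    rw [wproj_same, wproj_ne _ _ _ hij] at a
    rw [wproj_same, wproj_ne _ _ _ (Ne.symm hij)] at b
    rw [a, ← b]
    exact wmk_base _ _ _

lemma wedge_t2 [∀ i, T2Space (Y i)] : T2Space (Wedge Y y₀) :=
  T2Space.of_injective_continuous (f := fun w i => wproj y₀ i w)
    (fun v w h => wproj_inj y₀ v w (fun i => congrFun h i))
    (continuous_pi fun i => continuous_wproj y₀ i)
end wedge

/-- Extending a homeomorphism from an open set to the one-point compactification. -/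
lemma continuous_toOnePoint {X V : Type} [TopologicalSpace X] [TopologicalSpace V] [T2Space X]
    (O : Set X) (hO : IsOpen O) (h : X → V) (hc : ContinuousOn h O) (s : V → X)
    (hs : Continuous s) (hsO : ∀ v, s v ∈ O) (hhs : ∀ v, h (s v) = v)
    (hsh : ∀ x ∈ O, s (h x) = x) :
    Continuous (fun x => if x ∈ O then (h x : OnePoint V) else OnePoint.infty) := by
  rw [continuous_def]
  intro U hU
  by_cases hi : OnePoint.infty ∈ U
  · obtain ⟨-, hK⟩ := (OnePoint.isOpen_iff_of_mem hi).1 hU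
    have : ((fun x => if x ∈ O then (h x : OnePoint V) else OnePoint.infty) ⁻¹' U)ᶜ
        = s '' (((↑) ⁻¹' U : Set V)ᶜ) := by
      ext x
      simp only [Set.mem_compl_iff, Set.mem_preimage, Set.mem_image]
      constructor
      · intro hx
        by_cases hxO : x ∈ O
        · rw [if_pos hxO] at hx
          exact ⟨h x, hx, hsh x hxO⟩
        · rw [if_neg hxO] at hx; exact (hx hi).elim
      · rintro ⟨v, hv, rfl⟩
        rw [if_pos (hsO v), hhs]; exact hv
    rw [← isClosed_compl_iff, this]
    exact (hK.image hs).isClosed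
  · have h2 := (OnePoint.isOpen_iff_of_notMem hi).1 hU
    have : (fun x => if x ∈ O then (h x : OnePoint V) else OnePoint.infty) ⁻¹' U
        = O ∩ h ⁻¹' ((↑) ⁻¹' U : Set V) := by
      ext x
      simp only [Set.mem_preimage, Set.mem_inter_iff]
      by_cases hxO : x ∈ O
      · simp [hxO]
      · simp [hxO, hi]
    rw [this]
    exact hc.isOpen_inter_preimage hO h2
end PLW

open Function
namespace PLW
open Classical

lemma supp_eq_iff {V : Type} [Fintype V] {K : Set (Finset V)} {d : ℕ} (u : Fin (d + 1) → V)
    (hmax : ∀ t ∈ K, Finset.univ.image u ⊆ t → t = Finset.univ.image u) (x : V → ℝ)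
    (hx : x ∈ real K) : supp x = Finset.univ.image u ↔ ∀ i, 0 < x (u i) := by
  constructor
  · intro h i
    have : u i ∈ supp x := by rw [h]; simp
    exact lt_of_le_of_ne (hx.1 _) ((mem_supp _ _).1 this).symm
  · intro h
    refine hmax _ hx.2.2 ?_
    intro p hp
    obtain ⟨i, -, rfl⟩ := Finset.mem_image.1 hp
    exact (mem_supp _ _).2 (h i).ne'

lemma sum_cell {V : Type} [Fintype V] {d : ℕ} (u : Fin (d + 1) → V) (hu : Injective u)
    (x : V → ℝ) (h : ∀ p, p ∉ Finset.univ.image u → x p = 0) : ∑ p, x p = ∑ i, x (u i) := by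
  rw [← Finset.sum_subset (Finset.subset_univ (Finset.univ.image u)) (fun p _ hp => h p hp),
    Finset.sum_image (fun a _ b _ hab => hu hab)]

lemma exists_cell {V : Type} [Fintype V] {K : Set (Finset V)} {d : ℕ}
    (u : Fin (d + 1) → V) (hu : Injective u) (hmem : Finset.univ.image u ∈ K)
    (hmax : ∀ t ∈ K, Finset.univ.image u ⊆ t → t = Finset.univ.image u) :
    ∃ φ : real K → OnePoint (Fin d → ℝ), Continuous φ ∧
      (∀ x, φ x = OnePoint.infty ↔ supp x.1 ≠ Finset.univ.image u) ∧ (∀ v : Fin d → ℝ, ∃ x, φ x = v) ∧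
      (∀ x y, φ x = φ y → φ x ≠ OnePoint.infty → x = y) := by
  set O : Set (real K) := {x | ∀ i, 0 < x.1 (u i)} with hO
  have hOs : ∀ x : real K, x ∈ O ↔ supp x.1 = Finset.univ.image u := fun x =>
    (supp_eq_iff u hmax x.1 x.2).symm
  have Oopen : IsOpen O := by
    simp only [hO, Set.ofPred_forall]
    refine isOpen_iInter_of_finite fun i => isOpen_lt continuous_const ?_
    exact (continuous_apply _).comp continuous_subtype_val
  set h : real K → Fin d → ℝ := fun x i => Real.log (x.1 (u i.succ) / x.1 (u 0)) with hh
  have hc : ContinuousOn h O := by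
    refine continuousOn_pi.2 fun i => ?_
    have c1 : ∀ p, Continuous fun x : real K => x.1 p := fun p =>
      (continuous_apply p).comp continuous_subtype_val
    refine ContinuousOn.log (ContinuousOn.div (c1 _).continuousOn (c1 _).continuousOn ?_) ?_
    · intro x hx; exact (hx 0).ne'
    · intro x hx; exact (div_pos (hx _) (hx _)).ne'
  set e : (Fin d → ℝ) → Fin (d + 1) → ℝ := fun v => Fin.cons 1 (fun i => Real.exp (v i)) with he
  have epos : ∀ v i, 0 < e v i := by
    intro v i
    refine Fin.cases ?_ (fun i => ?_) i
    · simp [he]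
    · simp [he, Real.exp_pos]
  have econt : ∀ i, Continuous fun v => e v i := by
    intro i
    refine Fin.cases ?_ (fun i => ?_) i
    · simp only [he, Fin.cons_zero]; fun_prop
    · simp only [he, Fin.cons_succ]; fun_prop
  have Tpos : ∀ v, 0 < ∑ i, e v i := fun v => Finset.sum_pos (fun i _ => epos v i) (by simp)
  set s0 : (Fin d → ℝ) → V → ℝ := fun v p =>
    ∑ i, if u i = p then e v i / ∑ j, e v j else 0 with hs0
  have s0u : ∀ v i, s0 v (u i) = e v i / ∑ j, e v j := by
    intro v i
    simp only [hs0, hu.eq_iff]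
    simp
  have s0n : ∀ v p, p ∉ Finset.univ.image u → s0 v p = 0 := by
    intro v p hp
    simp only [hs0]
    refine Finset.sum_eq_zero fun i _ => if_neg ?_
    rintro rfl
    exact hp (by simp)
  have s0supp : ∀ v, supp (s0 v) = Finset.univ.image u := by
    intro v
    ext p
    rw [mem_supp]
    constructor
    · intro hp; by_contra hn; exact hp (s0n v p hn)
    · intro hp
      obtain ⟨i, -, rfl⟩ := Finset.mem_image.1 hp
      rw [s0u]; exact (div_pos (epos v i) (Tpos v)).ne'
  have s0m : ∀ v, s0 v ∈ real K := by
    intro v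
    refine ⟨?_, ?_, ?_⟩
    · intro p
      exact Finset.sum_nonneg fun i _ => by
        split_ifs
        · exact (div_pos (epos v i) (Tpos v)).le
        · exact le_rfl
    · rw [sum_cell u hu _ (s0n v)]
      simp only [s0u]
      rw [← Finset.sum_div, div_self (Tpos v).ne']
    · rw [s0supp]; exact hmem
  have hsO : ∀ v, (⟨s0 v, s0m v⟩ : real K) ∈ O := fun v => (hOs _).2 (s0supp v)
  have hs : Continuous fun v => (⟨s0 v, s0m v⟩ : real K) := by
    refine Continuous.subtype_mk ?_ _
    refine continuous_pi fun p => ?_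
    simp only [hs0]
    refine continuous_finsetSum _ fun i _ => ?_
    split_ifs
    · exact (econt i).div (continuous_finsetSum _ fun j _ => econt j) (fun v => (Tpos v).ne')
    · exact continuous_const
  have hhs : ∀ v, h ⟨s0 v, s0m v⟩ = v := by
    intro v
    ext i
    simp only [hh, s0u]
    rw [div_div_div_cancel_right₀ (Tpos v).ne']
    simp [he]
  have hsh : ∀ x ∈ O, (⟨s0 (h x), s0m (h x)⟩ : real K) = x := by
    intro x hx
    have hxs := (hOs x).1 hx
    have ee : ∀ i, e (h x) i = x.1 (u i) / x.1 (u 0) := by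
      intro i
      refine Fin.cases ?_ (fun i => ?_) i
      · simp [he, (hx 0).ne']
      · simp only [he, hh, Fin.cons_succ]
        rw [Real.exp_log (div_pos (hx _) (hx _))]
    have hz : ∀ p, p ∉ Finset.univ.image u → x.1 p = 0 := by
      intro p hp
      rw [← hxs, mem_supp] at hp
      simpa using hp
    have hT : ∑ i, e (h x) i = 1 / x.1 (u 0) := by
      simp only [ee]
      rw [← Finset.sum_div, ← sum_cell u hu _ hz, x.2.2.1]
    apply Subtype.ext
    ext p
    by_cases hp : p ∈ Finset.univ.image u
    · obtain ⟨i, -, rfl⟩ := Finset.mem_image.1 hp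
      show s0 (h x) (u i) = _
      rw [s0u, hT, ee]
      have := (hx 0).ne'
      field_simp
    · rw [hz p hp]; exact s0n _ p hp
  refine ⟨_, continuous_toOnePoint O Oopen h hc _ hs hsO hhs hsh, ?_, ?_, ?_⟩
  · intro x
    rw [Ne, ← hOs]
    by_cases hx : x ∈ O <;> simp [hx]
  · intro v
    refine ⟨⟨s0 v, s0m v⟩, ?_⟩
    have := hsO v
    simp only [this, if_true, hhs]
  · intro x y hxy hx
    by_cases hxO : x ∈ O
    · by_cases hyO : y ∈ O
      · simp only [hxO, hyO, if_true, OnePoint.coe_eq_coe] at hxy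
        rw [← hsh x hxO, ← hsh y hyO, hxy]
      · simp [hxO, hyO] at hxy
    · simp [hxO] at hx

lemma exists_collar {V : Type} [Fintype V] {K : Set (Finset V)} (hK : Down K) {d N : ℕ}
    (u : Fin N → Fin (d + 1) → V) (hu : ∀ j, Injective (u j))
    (hinj : ∀ i j, Finset.univ.image (u i) = Finset.univ.image (u j) → i = j)
    (hmax : ∀ j, ∀ t ∈ K, Finset.univ.image (u j) ⊆ t → t = Finset.univ.image (u j))
    (A : Set (Finset V)) (hA : A = {t | t ∈ K ∧ ∀ j, t ≠ Finset.univ.image (u j)})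
    (hAR : AR (real A)) :
    ∃ G : real K × unitInterval → real K, Continuous G ∧ (∀ x, G (x, 0) = x) ∧
      (∀ x, x.1 ∈ real A → ∀ t, (G (x, t)).1 ∈ real A) ∧
      (∀ x, x.1 ∈ real A → ∀ y, y.1 ∈ real A → G (x, 1) = G (y, 1)) := by
  have hAK : ∀ x ∈ real A, x ∈ real K := fun x hx => ⟨hx.1, hx.2.1, by
    have := hx.2.2; rw [hA] at this; exact this.1⟩
  have hAd : Down A := by
    rw [hA]
    rintro s ⟨hs, hs'⟩ t hts
    refine ⟨hK s hs t hts, fun j e => ?_⟩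
    subst e
    exact hs' j (hmax j s hs hts)
  have Acl := isClosed_real hAd
  obtain ⟨a₀, ha₀, k, kc, kA, k0, k1⟩ := hAR.contract Acl
  set m : Fin N → (V → ℝ) → ℝ := fun j x => Finset.univ.inf' Finset.univ_nonempty
    (fun i => x (u j i)) with hm
  have mcont : ∀ j, Continuous (m j) := by
    intro j
    simp only [hm]
    exact Continuous.finset_inf'_apply _ (fun i _ => continuous_apply _)
  have mle : ∀ j x i, m j x ≤ x (u j i) := fun j x i => Finset.inf'_le _ (Finset.mem_univ i)
  have mex : ∀ j x, ∃ i, m j x = x (u j i) := by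
    intro j x
    obtain ⟨i, -, hi⟩ := Finset.exists_mem_eq_inf' (Finset.univ_nonempty (α := Fin (d + 1)))
      (fun i => x (u j i))
    exact ⟨i, hi⟩
  have mnn : ∀ j x, x ∈ real K → 0 ≤ m j x := by
    intro j x hx
    obtain ⟨i, hi⟩ := mex j x
    rw [hi]; exact hx.1 _
  have mzero : ∀ j x, x ∈ real K → supp x ≠ Finset.univ.image (u j) → m j x = 0 := by
    intro j x hx hne
    by_contra h
    refine hne ((supp_eq_iff (u j) (hmax j) x hx).2 fun i => ?_)
    exact lt_of_lt_of_le (lt_of_le_of_ne (mnn j x hx) (Ne.symm h)) (mle j x i)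
  set c : ℝ := 1 / (2 * (d + 1)) with hc
  have cpos : 0 < c := by positivity
  have hdc : (d + 1) * c = 1 / 2 := by rw [hc]; field_simp
  set θ : Fin N → (V → ℝ) → ℝ → ℝ := fun j x s => min (m j x) (s * c) with hθ
  set S : (V → ℝ) → ℝ → ℝ := fun x s => ∑ j, θ j x s with hS
  set num : (V → ℝ) → ℝ → V → ℝ := fun x s p =>
    x p - ∑ j, if p ∈ Finset.univ.image (u j) then θ j x s else 0 with hnum
  set x' : (V → ℝ) → ℝ → V → ℝ := fun x s p => num x s p / (1 - (d + 1) * S x s) with hx'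
  set τ : (V → ℝ) → ℝ → ℝ := fun x s => s - S x s / c with hτ
  have θzero : ∀ j x s, x ∈ real K → 0 ≤ s → supp x ≠ Finset.univ.image (u j) →
      θ j x s = 0 := by
    intro j x s hx hs hne
    simp only [hθ, mzero j x hx hne]
    exact min_eq_left (by positivity)
  have caseA : ∀ x s, x ∈ real A → 0 ≤ s → x' x s = x ∧ τ x s = s := by
    intro x s hx hs
    have hne : ∀ j, supp x ≠ Finset.univ.image (u j) := by
      have := hx.2.2; rw [hA] at this; exact this.2
    have z : ∀ j, θ j x s = 0 := fun j => θzero j x s (hAK x hx) hs (hne j)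
    constructor
    · ext p; simp [hx', hnum, hS, z]
    · simp [hτ, hS, z]
  have caseS : ∀ x s j, x ∈ real K → 0 ≤ s → supp x = Finset.univ.image (u j) →
      S x s = θ j x s ∧ ∀ p, num x s p = x p - if p ∈ supp x then θ j x s else 0 := by
    intro x s j hx hs hj
    have z : ∀ i, i ≠ j → θ i x s = 0 := fun i hi => θzero i x s hx hs (fun e =>
      hi (hinj i j (e.symm.trans hj)))
    constructor
    · exact Finset.sum_eq_single j (fun i _ hi => z i hi) (by simp)
    · intro p
      simp only [hnum]
      rw [Finset.sum_eq_single j (fun i _ hi => by simp [z i hi]) (by simp), hj]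
  have cases : ∀ x, x ∈ real K → x ∈ real A ∨ ∃ j, supp x = Finset.univ.image (u j) := by
    intro x hx
    by_cases h : ∃ j, supp x = Finset.univ.image (u j)
    · exact Or.inr h
    · refine Or.inl ⟨hx.1, hx.2.1, ?_⟩
      rw [hA]
      exact ⟨hx.2.2, fun j e => h ⟨j, e⟩⟩
  have Sle : ∀ x s, x ∈ real K → 0 ≤ s → s ≤ 1 → 0 ≤ S x s ∧ S x s ≤ s * c := by
    intro x s hx hs hs1
    rcases cases x hx with h | ⟨j, hj⟩
    · have := (caseA x s h hs).2
      simp only [hτ] at this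
      have h0 : S x s = 0 := by
        have : S x s / c = 0 := by linarith
        rcases div_eq_zero_iff.1 this with h | h
        · exact h
        · exact (cpos.ne' h).elim
      rw [h0]; exact ⟨le_rfl, by positivity⟩
    · rw [(caseS x s j hx hs hj).1]
      exact ⟨le_min (mnn j x hx) (by positivity), min_le_right _ _⟩
  have Tpos : ∀ x s, x ∈ real K → 0 ≤ s → s ≤ 1 → 0 < 1 - (d + 1) * S x s := by
    intro x s hx hs hs1
    have h1 := (Sle x s hx hs hs1).2
    have h2 : S x s ≤ c := h1.trans (by nlinarith)
    have h3 : (d + 1) * S x s ≤ (d + 1) * c := by gcongr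
    rw [hdc] at h3
    linarith
  have x'K : ∀ x s, x ∈ real K → 0 ≤ s → s ≤ 1 → x' x s ∈ real K ∧ (0 < τ x s → x' x s ∈ real A) := by
    intro x s hx hs hs1
    rcases cases x hx with h | ⟨j, hj⟩
    · rw [(caseA x s h hs).1]; exact ⟨hx, fun _ => h⟩
    · obtain ⟨e1, e2⟩ := caseS x s j hx hs hj
      have tp := Tpos x s hx hs hs1
      have hzero : ∀ p, p ∉ supp x → x p = 0 := fun p hp => by
        rw [mem_supp] at hp; simpa using hp
      have hsub : supp (x' x s) ⊆ supp x := by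
        intro p hp
        by_contra hn
        apply (mem_supp _ _).1 hp
        simp [hx', e2, hn, hzero p hn]
      have hr : x' x s ∈ real K := by
        refine ⟨?_, ?_, hK _ hx.2.2 _ hsub⟩
        · intro p
          refine div_nonneg ?_ tp.le
          rw [e2]
          split_ifs with hp
          · rw [hj] at hp
            obtain ⟨i, -, rfl⟩ := Finset.mem_image.1 hp
            have := mle j x i
            have h2 : θ j x s ≤ m j x := min_le_left _ _
            linarith
          · rw [hzero p hp]; simp
        · simp only [hx']
          rw [← Finset.sum_div, div_eq_one_iff_eq tp.ne']
          simp only [e2, Finset.sum_sub_distrib, hx.2.1, e1]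
          rw [Finset.sum_ite_mem, Finset.univ_inter, Finset.sum_const, hj,
            Finset.card_image_of_injective _ (hu j)]
          simp
      refine ⟨hr, fun ht => ?_⟩
      have hθm : θ j x s = m j x := by
        simp only [hτ, e1] at ht
        have : θ j x s < s * c := by
          have : θ j x s / c < s := by linarith
          rwa [div_lt_iff₀ cpos] at this
        simp only [hθ] at this ⊢
        exact min_eq_left (by
          by_contra hcon
          rw [min_eq_right (by linarith)] at this
          exact lt_irrefl _ this)
      obtain ⟨i, hi⟩ := mex j x
      have hui : u j i ∈ supp x := by rw [hj]; simp
      have hz : x' x s (u j i) = 0 := by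
        simp only [hx', e2, hui, if_true, hθm, hi]; simp
      rcases cases _ hr with h | ⟨l, hl⟩
      · exact h
      · exfalso
        have : supp x = Finset.univ.image (u l) := hmax l _ hx.2.2 (hl ▸ hsub)
        rw [this, ← hl] at hui
        exact (mem_supp _ _).1 hui hz
  have τnn : ∀ x s, x ∈ real K → 0 ≤ s → s ≤ 1 → 0 ≤ τ x s := by
    intro x s hx hs hs1
    have h1 := (Sle x s hx hs hs1).2
    simp only [hτ]
    have : S x s / c ≤ s := by rw [div_le_iff₀ cpos]; exact h1
    linarith
  have cx : ∀ p, Continuous fun z : real K × unitInterval => z.1.1 p := fun p =>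
    (continuous_apply p).comp (continuous_subtype_val.comp continuous_fst)
  have cθ : ∀ j, Continuous fun z : real K × unitInterval => θ j z.1.1 z.2.1 := by
    intro j
    simp only [hθ]
    have : Continuous fun z : real K × unitInterval => m j z.1.1 :=
      (mcont j).comp (continuous_subtype_val.comp continuous_fst)
    fun_prop
  have cS : Continuous fun z : real K × unitInterval => S z.1.1 z.2.1 :=
    continuous_finsetSum _ fun j _ => cθ j
  have cτ : Continuous fun z : real K × unitInterval => τ z.1.1 z.2.1 := by
    simp only [hτ]
    fun_prop
  have cx' : Continuous fun z : real K × unitInterval => x' z.1.1 z.2.1 := by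
    refine continuous_pi fun p => ?_
    simp only [hx']
    refine Continuous.div ?_ (by fun_prop) (fun z => (Tpos _ _ z.1.2 z.2.2.1 z.2.2.2).ne')
    simp only [hnum]
    refine (cx p).sub (continuous_finsetSum _ fun j _ => ?_)
    split_ifs
    · exact cθ j
    · exact continuous_const
  set g : real K × unitInterval → V → ℝ := fun z =>
    if τ z.1.1 z.2.1 ≤ 0 then x' z.1.1 z.2.1 else k (x' z.1.1 z.2.1, τ z.1.1 z.2.1) with hg
  have gA : ∀ z : real K × unitInterval, x' z.1.1 z.2.1 ∈ real A →
      g z = k (x' z.1.1 z.2.1, τ z.1.1 z.2.1) := by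
    intro z hz
    simp only [hg]
    split_ifs with h
    · rw [le_antisymm h (τnn _ _ z.1.2 z.2.2.1 z.2.2.2), k0 _ hz]
    · rfl
  have gcont : Continuous g := by
    have cov : {z : real K × unitInterval | τ z.1.1 z.2.1 ≤ 0} ∪
        {z : real K × unitInterval | x' z.1.1 z.2.1 ∈ real A} = Set.univ := by
      rw [Set.eq_univ_iff_forall]
      intro z
      by_cases h : τ z.1.1 z.2.1 ≤ 0
      · exact Or.inl h
      · exact Or.inr ((x'K _ _ z.1.2 z.2.2.1 z.2.2.2).2 (not_le.1 h))
    rw [← continuousOn_univ, ← cov]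
    refine ContinuousOn.union_of_isClosed ?_ ?_ (isClosed_le cτ continuous_const)
      (Acl.preimage cx')
    · refine cx'.continuousOn.congr ?_
      intro z hz
      exact if_pos hz
    · refine (kc.comp (cx'.prodMk cτ)).continuousOn.congr ?_
      intro z hz
      exact gA z hz
  have gK : ∀ z, g z ∈ real K := by
    intro z
    simp only [hg]
    split_ifs
    · exact (x'K _ _ z.1.2 z.2.2.1 z.2.2.2).1
    · exact hAK _ (kA _)
  have gA' : ∀ (x : real K), x.1 ∈ real A → ∀ t : unitInterval, g (x, t) = k (x.1, t.1) := by
    intro x hx t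
    obtain ⟨e1, e2⟩ := caseA x.1 t.1 hx t.2.1
    rw [gA (x, t) (by simp only [e1]; exact hx)]
    simp only [e1, e2]
  refine ⟨fun z => ⟨g z, gK z⟩, gcont.subtype_mk _, ?_, ?_, ?_⟩
  · intro x
    apply Subtype.ext
    show g (x, 0) = x.1
    have hS0 : S x.1 0 = 0 := by
      have := Sle x.1 0 x.2 le_rfl zero_le_one
      rw [zero_mul] at this
      exact le_antisymm this.2 this.1
    have hτ0 : τ x.1 0 = 0 := by simp [hτ, hS0]
    have hx0 : x' x.1 0 = x.1 := by
      rcases cases x.1 x.2 with h | ⟨j, hj⟩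
      · exact (caseA _ _ h le_rfl).1
      · obtain ⟨e1, e2⟩ := caseS x.1 0 j x.2 le_rfl hj
        rw [hS0] at e1
        ext p
        simp [hx', hS0, e2, ← e1]
    simp [hg, hτ0, hx0]
  · intro x hx t
    show g (x, t) ∈ _
    rw [gA' x hx]
    exact kA _
  · intro x hx y hy
    apply Subtype.ext
    show g (x, 1) = g (y, 1)
    rw [gA' x hx, gA' y hy]
    exact (k1 _ hx).trans (k1 _ hy).symm

theorem wedge_of_cells {V : Type} [Fintype V] {K : Set (Finset V)} (hK : Down K) {d N : ℕ}
    (hN : 0 < N)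
    (u : Fin N → Fin (d + 1) → V) (hu : ∀ j, Injective (u j))
    (hinj : ∀ i j, Finset.univ.image (u i) = Finset.univ.image (u j) → i = j)
    (hmem : ∀ j, Finset.univ.image (u j) ∈ K)
    (hmax : ∀ j, ∀ t ∈ K, Finset.univ.image (u j) ⊆ t → t = Finset.univ.image (u j))
    (hAR : AR (real {t | t ∈ K ∧ ∀ j, t ≠ Finset.univ.image (u j)})) :
    ∃ b : ∀ _ : Fin N, ↥(Metric.sphere (0 : EuclideanSpace ℝ (Fin (d + 1))) 1),
      Nonempty (ContinuousMap.HomotopyEquiv ↥(real K)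
        (Wedge (fun _ : Fin N =>
          ↥(Metric.sphere (0 : EuclideanSpace ℝ (Fin (d + 1))) 1)) b)) := by
  set A : Set (Finset V) := {t | t ∈ K ∧ ∀ j, t ≠ Finset.univ.image (u j)} with hA
  obtain ⟨G, Gc, G0, GA, G1⟩ := exists_collar hK u hu hinj hmax A hA hAR
  choose φ φc φi φs φj using fun j => exists_cell (u j) (hu j) (hmem j) (hmax j)
  let Φ : OnePoint (Fin d → ℝ) ≃ₜ Metric.sphere (0 : EuclideanSpace ℝ (Fin (d + 1))) 1 :=
    onePointEquivSphereOfFinrankEq (by simp)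
  let b : ∀ _ : Fin N, ↥(Metric.sphere (0 : EuclideanSpace ℝ (Fin (d + 1))) 1) :=
    fun _ => Φ OnePoint.infty
  refine ⟨b, ?_⟩
  have hAd : Down A := by
    rintro s ⟨hs, hs'⟩ t hts
    refine ⟨hK s hs t hts, fun j e => ?_⟩
    subst e
    exact hs' j (hmax j s hs hts)
  have Acl := isClosed_real hAd
  have : CompactSpace (real K) := isCompact_iff_compactSpace.1 (isCompact_real hK)
  have : T2Space (Wedge (fun _ : Fin N =>
          ↥(Metric.sphere (0 : EuclideanSpace ℝ (Fin (d + 1))) 1)) b) := wedge_t2 b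
  have memA : ∀ x : real K, x.1 ∈ real A ↔ ∀ j, supp x.1 ≠ Finset.univ.image (u j) := by
    intro x
    constructor
    · intro h; exact h.2.2.2
    · intro h; exact ⟨x.2.1, x.2.2.1, x.2.2.2, h⟩
  let f : real K → Wedge (fun _ : Fin N =>
          ↥(Metric.sphere (0 : EuclideanSpace ℝ (Fin (d + 1))) 1)) b := fun x =>
    if h : ∃ j, supp x.1 = Finset.univ.image (u j) then wmk b h.choose (Φ (φ h.choose x))
    else wmk b ⟨0, hN⟩ (b ⟨0, hN⟩)
  have fS : ∀ x j, supp x.1 = Finset.univ.image (u j) → f x = wmk b j (Φ (φ j x)) := by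
    intro x j hj
    have h : ∃ j, supp x.1 = Finset.univ.image (u j) := ⟨j, hj⟩
    have e : h.choose = j := hinj _ _ (h.choose_spec.symm.trans hj)
    simp only [f]
    rw [dif_pos h, e]
  have fA : ∀ x : real K, x.1 ∈ real A → ∀ j, f x = wmk b j (b j) := by
    intro x hx j
    simp only [f]
    rw [dif_neg (by rintro ⟨i, hi⟩; exact (memA x).1 hx i hi)]
    exact wmk_base b _ _
  have fB : ∀ x : real K, ∀ j, supp x.1 ⊆ Finset.univ.image (u j) →
      f x = wmk b j (Φ (φ j x)) := by
    intro x j hj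
    by_cases h : ∃ i, supp x.1 = Finset.univ.image (u i)
    · obtain ⟨i, hi⟩ := h
      have : i = j := hinj _ _ (hmax i _ (hmem j) (hi ▸ hj)).symm
      subst this
      exact fS x i hi
    · have hx : x.1 ∈ real A := (memA x).2 (fun i hi => h ⟨i, hi⟩)
      rw [fA x hx j, (φi j x).2 ((memA x).1 hx j)]
  have fc : Continuous f := by
    let Cs : Option (Fin N) → Set (real K) := fun o => match o with
      | none => {x | x.1 ∈ real A}
      | some j => {x | ∀ p, p ∉ Finset.univ.image (u j) → x.1 p = 0}
    refine (locallyFinite_of_finite Cs).continuous ?_ ?_ ?_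
    · rw [Set.eq_univ_iff_forall]
      intro x
      rw [Set.mem_iUnion]
      by_cases h : ∃ j, supp x.1 = Finset.univ.image (u j)
      · obtain ⟨j, hj⟩ := h
        refine ⟨some j, fun p hp => ?_⟩
        rw [← hj, mem_supp] at hp
        simpa using hp
      · exact ⟨none, (memA x).2 (fun j hj => h ⟨j, hj⟩)⟩
    · rintro (_ | j)
      · exact Acl.preimage continuous_subtype_val
      · show IsClosed {x : real K | ∀ p, p ∉ Finset.univ.image (u j) → x.1 p = 0}
        simp only [Set.ofPred_forall]
        exact isClosed_iInter fun p => isClosed_iInter fun _ =>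
          isClosed_eq ((continuous_apply p).comp continuous_subtype_val) continuous_const
    · rintro (_ | j)
      · have : ContinuousOn (fun _ : real K => wmk b ⟨0, hN⟩ (b ⟨0, hN⟩)) (Cs none) :=
          continuousOn_const
        refine this.congr ?_
        intro x hx
        exact fA x hx _
      · refine ((continuous_wmk b j).comp (Φ.continuous.comp (φc j))).continuousOn.congr ?_
        intro x hx
        refine fB x j ?_
        intro p hp
        by_contra hn
        exact (mem_supp _ _).1 hp (hx p hn)
  have projS : ∀ x j, supp x.1 = Finset.univ.image (u j) → wproj b j (f x) ≠ b j := by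
    intro x j hj h
    rw [fS x j hj, wproj_same] at h
    exact (φi j x).1 (Φ.injective h) hj
  obtain ⟨a₀, ha₀, -⟩ := hAR.contract Acl
  refine hequiv_of_collapse f fc ?_ {x | x.1 ∈ real A} ?_ ?_ G Gc G0 GA G1
  · intro w
    obtain ⟨j, y, rfl⟩ := wmk_surj b w
    obtain ⟨z, rfl⟩ := Φ.surjective y
    induction z using OnePoint.rec with
    | infty => exact ⟨⟨a₀, ha₀.1, ha₀.2.1, ha₀.2.2.1⟩, fA _ ha₀ j⟩
    | coe v =>
      obtain ⟨x, hx⟩ := φs j v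
      refine ⟨x, ?_⟩
      rw [fS x j, hx]
      by_contra hn
      rw [(φi j x).2 hn] at hx
      exact OnePoint.infty_ne_coe _ hx
  · intro x y hxy
    have half : ∀ x y j, f x = f y → supp x.1 = Finset.univ.image (u j) → x = y := by
      intro x y j hxy hj
      have h1 := projS x j hj
      rw [hxy] at h1
      by_cases hy : ∃ i, supp y.1 = Finset.univ.image (u i)
      · obtain ⟨i, hi⟩ := hy
        by_cases hij : i = j
        · subst hij
          rw [fS x i hj, fS y i hi] at hxy
          have := congrArg (wproj b i) hxy
          rw [wproj_same, wproj_same] at this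
          exact φj i x y (Φ.injective this) (fun h => (φi i x).1 h hj)
        · rw [fS y i hi, wproj_ne b _ _ hij] at h1
          exact (h1 rfl).elim
      · rw [fA y ((memA y).2 (fun i hi => hy ⟨i, hi⟩)) j, wproj_same] at h1
        exact (h1 rfl).elim
    by_cases hx : ∃ j, supp x.1 = Finset.univ.image (u j)
    · obtain ⟨j, hj⟩ := hx
      exact Or.inl (half x y j hxy hj)
    by_cases hy : ∃ j, supp y.1 = Finset.univ.image (u j)
    · obtain ⟨j, hj⟩ := hy
      exact Or.inl (half y x j hxy.symm hj).symm
    exact Or.inr ⟨(memA x).2 (fun i hi => hx ⟨i, hi⟩), (memA y).2 (fun i hi => hy ⟨i, hi⟩)⟩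
  · intro x hx y hy
    rw [fA x hx ⟨0, hN⟩, fA y hy ⟨0, hN⟩]
end PLW

open Function
namespace PLW
open Classical

/-- Proper part of the partition lattice of an arbitrary type. -/
abbrev PP (α : Type) : Type := {r : Setoid α // r ≠ ⊥ ∧ r ≠ ⊤}

instance finite_setoid (α : Type) [Finite α] : Finite (Setoid α) :=
  Finite.of_injective (fun r : Setoid α => (fun a b => r a b : α → α → Prop)) (by
    intro r s h
    ext a b
    exact iff_of_eq (congrFun (congrFun h a) b))

/-- The partition whose only nontrivial block is `{i, x}`. -/
def atom {α : Type} (x i : α) : Setoid α where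
  r u v := u = v ∨ (u = i ∧ v = x) ∨ (u = x ∧ v = i)
  iseqv := ⟨fun _ => Or.inl rfl, by
    intro u v h; grind, by
    intro u v w h1 h2; grind⟩

lemma atom_rel {α : Type} (x i u v : α) :
    atom x i u v ↔ u = v ∨ (u = i ∧ v = x) ∨ (u = x ∧ v = i) := Iff.rfl

/-- The partition with blocks `{x}` and its complement. -/
def coat {α : Type} (x : α) : Setoid α where
  r u v := u = x ↔ v = x
  iseqv := ⟨fun _ => Iff.rfl, fun h => h.symm, fun h1 h2 => h1.trans h2⟩

lemma coat_rel {α : Type} (x u v : α) : coat x u v ↔ (u = x ↔ v = x) := Iff.rfl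

lemma bot_of {α : Type} {r : Setoid α} (h : ∀ u v, r u v → u = v) : r = ⊥ :=
  le_bot_iff.1 (fun u v huv => h u v huv)

lemma exists_of_ne_bot {α : Type} {r : Setoid α} (h : r ≠ ⊥) : ∃ u v, r u v ∧ u ≠ v := by
  by_contra hc
  push Not at hc
  exact h (bot_of hc)

noncomputable def linkIso {α : Type} (r : Setoid α) (hr : r ≠ ⊥ ∧ r ≠ ⊤) :
    PP (Quotient r) ≃o {x : PP α | (⟨r, hr⟩ : PP α) < x} :=
  have htop : Setoid.correspondence r ⟨⊤, le_top⟩ = ⊤ := by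
    refine top_le_iff.1 ?_
    rw [← OrderIso.symm_apply_le]
    exact Subtype.mk_le_mk.2 le_top
  have hbot : Setoid.correspondence r ⟨r, le_rfl⟩ = ⊥ := by
    refine le_bot_iff.1 ?_
    rw [← OrderIso.le_symm_apply]
    exact ((Setoid.correspondence r).symm ⊥).2
  { toFun := fun q => ⟨⟨((Setoid.correspondence r).symm q.1).1, by
        intro h
        have := ((Setoid.correspondence r).symm q.1).2
        rw [h] at this
        exact hr.1 (le_bot_iff.1 this), by
        intro h
        apply q.2.2
        exact ((OrderIso.symm_apply_eq _).1 (Subtype.ext h : _ = ⟨⊤, le_top⟩)).trans htop⟩, by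
        refine lt_of_le_of_ne ((Setoid.correspondence r).symm q.1).2 ?_
        intro h
        apply q.2.1
        exact ((OrderIso.symm_apply_eq _).1
          (Subtype.ext h.symm : _ = ⟨r, le_rfl⟩)).trans hbot⟩
    invFun := fun s => ⟨Setoid.correspondence r ⟨s.1.1, s.2.le⟩, by
        intro h
        rw [← hbot] at h
        have := (Setoid.correspondence r).injective h
        exact s.2.ne (Subtype.ext (congrArg Subtype.val this).symm), by
        intro h
        rw [← htop] at h
        have := (Setoid.correspondence r).injective h
        exact s.1.2.2 (congrArg Subtype.val this)⟩
    left_inv := by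
      intro q
      apply Subtype.ext
      exact (Setoid.correspondence r).apply_symm_apply q.1
    right_inv := by
      intro s
      apply Subtype.ext
      apply Subtype.ext
      show ((Setoid.correspondence r).symm (Setoid.correspondence r ⟨s.1.1, s.2.le⟩)).1 = s.1.1
      rw [OrderIso.symm_apply_apply]
    map_rel_iff' := by
      intro a b
      exact (Setoid.correspondence r).symm.le_iff_le }

lemma sph_partition (n : ℕ) : ∀ (α : Type) [Finite α], Nat.card α = n + 2 →
    Sph (PP α) n (Nat.factorial (n + 1)) := by
  induction n with
  | zero =>
    intro α _ hα
    have hemp : IsEmpty (PP α) := by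
      refine ⟨fun r => ?_⟩
      obtain ⟨r, h1, h2⟩ := r
      obtain ⟨u, v, huv, hne⟩ := exists_of_ne_bot h1
      apply h2
      refine top_le_iff.1 ?_
      intro a b _
      have : ∀ c, c = u ∨ c = v := by
        intro c
        by_contra hc
        push Not at hc
        have h3 : ({c, u, v} : Finset α).card = 3 := by
          rw [Finset.card_eq_three]
          exact ⟨c, u, v, hc.1, hc.2, hne, rfl⟩
        have := Fintype.ofFinite α
        have h4 := Finset.card_le_univ ({c, u, v} : Finset α)
        rw [Nat.card_eq_fintype_card] at hα
        omega
      rcases this a with rfl | rfl <;> rcases this b with rfl | rfl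
      · exact r.refl' _
      · exact huv
      · exact r.symm' huv
      · exact r.refl' _
    have hall : ∀ t : Finset (PP α), t = ∅ := fun t => Finset.eq_empty_of_isEmpty t
    refine ⟨{∅}, Set.finite_singleton _, by simp, ?_, ?_⟩
    · rintro t rfl
      exact ⟨by simp, ⟨by simp, by simp⟩, fun s _ _ => hall s⟩
    · left
      ext t
      simp [hall t]
  | succ n ih =>
    intro α _ hα
    have := Fintype.ofFinite α
    have := Fintype.ofFinite (PP α)
    have hα' : Fintype.card α = n + 3 := by rw [← Nat.card_eq_fintype_card, hα]
    obtain ⟨x⟩ : Nonempty α := Fintype.card_pos_iff.1 (by omega)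
    -- there are enough points
    have hthird : ∀ a b : α, ∃ c, c ≠ a ∧ c ≠ b := by
      intro a b
      by_contra hc
      push Not at hc
      have h1 : (Finset.univ : Finset α) ⊆ {a, b} := by
        intro c _
        by_cases h : c = a
        · simp [h]
        · simp [hc c h]
      have h2 := Finset.card_le_card h1
      have h3 : ({a, b} : Finset α).card ≤ 2 := Finset.card_le_two
      rw [Finset.card_univ] at h2
      omega
    have hcoat : coat x ≠ ⊥ ∧ coat x ≠ ⊤ := by
      obtain ⟨c, hc, -⟩ := hthird x x
      obtain ⟨e, he, he'⟩ := hthird x c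
      constructor
      · intro h
        have : coat x c e := by rw [coat_rel]; tauto
        rw [h] at this
        exact he' (this : c = e).symm
      · intro h
        have : coat x c x := by rw [h]; trivial
        rw [coat_rel] at this
        exact hc (this.2 rfl)
    have hatom : ∀ i, i ≠ x → atom x i ≠ ⊥ ∧ atom x i ≠ ⊤ := by
      intro i hi
      constructor
      · intro h
        have : atom x i i x := by rw [atom_rel]; tauto
        rw [h] at this
        exact hi this
      · intro h
        obtain ⟨c, hc, hc'⟩ := hthird x i
        have : atom x i c x := by rw [h]; trivial
        rw [atom_rel] at this
        tauto
    have hcardI : Fintype.card {i : α // i ≠ x} = n + 2 := by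
      rw [Fintype.card_subtype_compl, Fintype.card_subtype_eq, hα']; omega
    let ε : Fin (n + 2) ≃ {i : α // i ≠ x} := (Fintype.equivFinOfCardEq hcardI).symm
    let y : Fin (n + 2) → PP α := fun j => ⟨atom x (ε j).1, hatom _ (ε j).2⟩
    have atomle : ∀ i (r : Setoid α), r i x → atom x i ≤ r := by
      intro i r h u v huv
      rcases (atom_rel x i u v).1 huv with rfl | ⟨rfl, rfl⟩ | ⟨rfl, rfl⟩
      · exact r.refl' _
      · exact h
      · exact r.symm' h
    have hy : Injective y := by
      intro j l h
      have h1 : atom x (ε j).1 = atom x (ε l).1 := congrArg Subtype.val h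
      have h2 : atom x (ε l).1 (ε j).1 x := by rw [← h1, atom_rel]; tauto
      rw [atom_rel] at h2
      have h3 := (ε j).2
      apply ε.injective
      apply Subtype.ext
      tauto
    have hmin : ∀ j, IsMin (y j) := by
      rintro j ⟨s, hs⟩ hle
      obtain ⟨u, v, huv, hne⟩ := exists_of_ne_bot hs.1
      refine atomle _ _ ?_
      have h1 : atom x (ε j).1 u v := hle huv
      show s _ _
      rcases (atom_rel _ _ u v).1 h1 with h | ⟨rfl, rfl⟩ | ⟨rfl, h⟩
      · exact (hne h).elim
      · exact huv
      · rw [← h]; exact s.symm' huv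
    have hrange : ∀ r : PP α, r ∉ Set.range y → r.1 ⊓ coat x ≠ ⊥ := by
      rintro ⟨r, hr⟩ hny hbot
      apply hny
      have hdis : ∀ u v, r u v → u ≠ x → v ≠ x → u = v := by
        intro u v h hu hv
        have : (r ⊓ coat x) u v := ⟨h, by rw [← Setoid.comm', coat_rel]; tauto⟩
        rw [hbot] at this
        exact this
      obtain ⟨i, hi, hix⟩ : ∃ i, i ≠ x ∧ r i x := by
        obtain ⟨u, v, huv, hne⟩ := exists_of_ne_bot hr.1
        by_cases hu : u = x
        · subst hu; exact ⟨v, hne.symm, r.symm' huv⟩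
        · by_cases hv : v = x
          · subst hv; exact ⟨u, hne, huv⟩
          · exact (hne (hdis u v huv hu hv)).elim
      refine ⟨ε.symm ⟨i, hi⟩, ?_⟩
      apply Subtype.ext
      show atom x (ε (ε.symm ⟨i, hi⟩)).1 = r
      rw [Equiv.apply_symm_apply]
      refine le_antisymm (atomle i r hix) ?_
      intro u v huv
      show atom x i u v
      rw [atom_rel]
      by_cases hu : u = x
      · by_cases hv : v = x
        · left; rw [hu, hv]
        · right; right
          subst hu
          exact ⟨rfl, hdis v i (r.trans' (r.symm' huv) (r.symm' hix)) hv hi⟩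
      · by_cases hv : v = x
        · right; left
          subst hv
          exact ⟨hdis u i (r.trans' huv (r.symm' hix)) hu hi, rfl⟩
        · left; exact hdis u v huv hu hv
    have hyle : ∀ j, ¬ atom x (ε j).1 ≤ coat x := by
      intro j h
      have h1 : coat x (ε j).1 x := h (by show atom x (ε j).1 (ε j).1 x; rw [atom_rel]; tauto)
      rw [coat_rel] at h1
      exact (ε j).2 (h1.2 rfl)
    have hS : Coll (chains ((Set.range y)ᶜ)) := by
      refine coll_conical _ ⟨coat x, hcoat⟩ ?_
        (fun r => if h : r.1 ⊓ coat x ≠ ⊥ then ⟨r.1 ⊓ coat x, h, fun e => r.2.2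
          (top_le_iff.1 (e.symm.le.trans inf_le_left))⟩ else r) ?_
      · rintro ⟨j, hj⟩
        exact hyle j (congrArg Subtype.val hj).le
      · intro r hr hra
        rw [dif_pos (hrange r hr)]
        refine ⟨?_, (show r.1 ⊓ coat x ≤ coat x from inf_le_right), lt_of_le_of_ne (show r.1 ⊓ coat x ≤ r.1 from inf_le_left) ?_, ?_⟩
        · rintro ⟨j, hj⟩
          have : atom x (ε j).1 = r.1 ⊓ coat x := congrArg Subtype.val hj
          exact hyle j (this.le.trans inf_le_right)
        · intro h
          have h1 : r.1 ⊓ coat x = r.1 := congrArg Subtype.val h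
          exact hra (inf_eq_left.1 h1)
        · intro s _ hsa hsr
          exact le_inf (show s.1 ≤ r.1 from hsr.le) hsa
    have := Sph.step (k := n) (N := Nat.factorial (n + 1)) y hy hmin hS (by
      intro j
      refine ⟨PP (Quotient (atom x (ε j).1)), inferInstance, ih _ ?_, ⟨linkIso _ (hatom _ (ε j).2)⟩⟩
      refine Eq.trans (Eq.symm ?_) ((Nat.card_eq_fintype_card).trans hcardI)
      refine Nat.card_eq_of_bijective (fun v : {i : α // i ≠ x} =>
        (Quotient.mk (atom x (ε j).1) v.1)) ⟨?_, ?_⟩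
      · intro v w h
        have h1 : atom x (ε j).1 v.1 w.1 := Quotient.exact h
        have h2 := v.2
        have h3 := w.2
        rw [atom_rel] at h1
        apply Subtype.ext
        tauto
      · intro q
        induction q using Quotient.ind with
        | _ v =>
          by_cases hv : v = x
          · refine ⟨ε j, Quotient.sound ?_⟩
            show atom x (ε j).1 (ε j).1 v
            rw [atom_rel]; tauto
          · exact ⟨⟨v, hv⟩, rfl⟩)
    rwa [← Nat.factorial_succ] at this

lemma orderComplex_eq {P : Type} [Fintype P] [PartialOrder P] :
    orderComplex P = real (chains (Set.univ : Set P)) := by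
  ext w
  have hs : ((supp w : Finset P) : Set P) = support w := by
    ext p; simp [mem_supp]
  constructor
  · rintro ⟨h1, -, h3, h4⟩
    rw [finsum_eq_sum_of_fintype] at h3
    refine ⟨h1, h3, by simp, ?_⟩
    rw [hs]; exact h4
  · rintro ⟨h1, h3, -, h4⟩
    rw [hs] at h4
    refine ⟨h1, Set.toFinite _, ?_, h4⟩
    rw [finsum_eq_sum_of_fintype]; exact h3

lemma wedge_of_sph {P : Type} [Finite P] [PartialOrder P] {d N : ℕ} (hN : 0 < N)
    (h : Sph P (d + 1) N) :
    ∃ b : ∀ _ : Fin N, ↥(Metric.sphere (0 : EuclideanSpace ℝ (Fin (d + 1))) 1),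
      Nonempty (ContinuousMap.HomotopyEquiv ↥(orderComplex P)
        (Wedge (fun _ : Fin N =>
          ↥(Metric.sphere (0 : EuclideanSpace ℝ (Fin (d + 1))) 1)) b)) := by
  have := Fintype.ofFinite P
  obtain ⟨F, F0, F1, F2, F3⟩ := h
  have := F0.to_subtype
  let e : F ≃ Fin N := Finite.equivFinOfCardEq F1
  let ue : ∀ j : Fin N, (e.symm j).1 ≃ Fin (d + 1) := fun j =>
    Finset.equivFinOfCardEq (F2 _ (e.symm j).2).1
  let u : Fin N → Fin (d + 1) → P := fun j i => ((ue j).symm i).1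
  have hu : ∀ j, Finset.univ.image (u j) = (e.symm j).1 := by
    intro j
    ext p
    simp only [Finset.mem_image, Finset.mem_univ, true_and]
    constructor
    · rintro ⟨i, rfl⟩; exact ((ue j).symm i).2
    · intro hp
      exact ⟨ue j ⟨p, hp⟩, by simp [u]⟩
  rw [orderComplex_eq]
  refine wedge_of_cells (chains_down _) hN u ?_ ?_ ?_ ?_ ?_
  · intro j a b hab
    exact (ue j).symm.injective (Subtype.ext hab)
  · intro i j hij
    rw [hu, hu] at hij
    exact e.symm.injective (Subtype.ext hij)
  · intro j
    rw [hu]; exact (F2 _ (e.symm j).2).2.1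
  · intro j
    rw [hu]; exact (F2 _ (e.symm j).2).2.2
  · have hset : {t | t ∈ chains (Set.univ : Set P) ∧ ∀ j, t ≠ Finset.univ.image (u j)} =
        chains (Set.univ : Set P) \ F := by
      ext t
      refine and_congr_right fun _ => ?_
      simp only [hu]
      constructor
      · intro h ht
        apply h (e ⟨t, ht⟩)
        simp
      · rintro h j rfl
        exact h (e.symm j).2
    rw [hset]
    rcases F3 with h | h
    · exfalso
      have : (∅ : Finset P) ∈ chains (Set.univ : Set P) \ F := by
        refine ⟨⟨by simp, by simp⟩, fun hF => ?_⟩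
        have := (F2 _ hF).1
        simp at this
      rw [h] at this
      exact this
    · exact h.ar
end PLW

theorem orderComplex_partitionLattice_wedge_of_spheres (n : ℕ) (hn : 3 ≤ n) :
    ∃ b : ∀ _ : Fin (Nat.factorial (n - 1)),
        ↥(Metric.sphere (0 : EuclideanSpace ℝ (Fin (n - 2))) 1),
      Nonempty (ContinuousMap.HomotopyEquiv
        ↥(orderComplex (properPartitionLattice n))
        (Wedge (fun _ : Fin (Nat.factorial (n - 1)) =>
          ↥(Metric.sphere (0 : EuclideanSpace ℝ (Fin (n - 2))) 1)) b)) := by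
  obtain ⟨d, rfl⟩ : ∃ d, n = d + 3 := ⟨n - 3, by omega⟩
  have h : PLW.Sph (PLW.PP (Fin (d + 3))) (d + 1) (Nat.factorial (d + 2)) :=
    PLW.sph_partition (d + 1) (Fin (d + 3)) (by simp)
  exact PLW.wedge_of_sph (P := PLW.PP (Fin (d + 3))) (Nat.factorial_pos _) h
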